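/- Let 0 < s̃ < 1 and 0 < t̃ < 1, and let g ∈ Sp(2) with first row (a,b). Then the following are equivalent. (A) There exist X, Y ∈ sp(2) such that X̃ and Ỹ are linearly independent over ℝ, the five bracket conditions [X̃,Ỹ] = 0, [X̃_k,Ỹ_k] = 0, [X_p,Y_p] = 0, [X_q,Y_q] = 0, [X_h,Y_h] = 0 all hold, and X̃ and Ỹ are both horizontal at g (for the parameter s̃). (B) At least one of the following holds: (Z₁) a ≠ 0, b ≠ 0 and D(a,b) = 0; (Z₂) |a| = |b|, ⟨w − 2·a⁻¹·w·a, w⟩ = 0 where w = Im(a⁻¹·b), and |Im a| ≥ |a|/2; (Z₃) b = 0 and |Im a| ≥ 1/2; (Z₄) a = 0 and |Im b| ≥ 1/2. -/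

import Mathlib

open scoped Quaternion
open Matrix

noncomputable section

/-- Real inner product on quaternions: ⟨x,y⟩ = Re(x̄·y). -/
def qip (x y : ℍ[ℝ]) : ℝ := (star x * y).re

/-- 2×2 quaternionic matrices. -/
abbrev M2 : Type := Matrix (Fin 2) (Fin 2) ℍ[ℝ]

/-- Diagonal 2×2 matrix diag(x,y). -/
def dg (x y : ℍ[ℝ]) : M2 := !![x, 0; 0, y]

/-- Diagonal (k-)part of a 2×2 matrix. -/
def Kpart (A : M2) : M2 := dg (A 0 0) (A 1 1)

/-- Off-diagonal (p-)part of a 2×2 matrix. -/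
def Ppart (A : M2) : M2 := A - Kpart A

/-- g ∈ Sp(2): g*·g = 1. -/
def Sp2 (g : M2) : Prop := gᴴ * g = 1

/-- ⟨A,B⟩ = Re trace(A*·B). -/
def mip (A B : M2) : ℝ := ((Aᴴ * B).trace).re

/-- ⟨A,B⟩₁ = ⟨A_p,B_p⟩ + s̃·⟨A_k,B_k⟩. -/
def mip1 (s : ℝ) (A B : M2) : ℝ := mip (Ppart A) (Ppart B) + s * mip (Kpart A) (Kpart B)

/-- v_g = g⁻¹·diag(v,0)·g − diag(v,v)  (with g⁻¹ = gᴴ for g ∈ Sp(2)). -/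
def vmat (g : M2) (v : ℍ[ℝ]) : M2 := gᴴ * dg v 0 * g - dg v v

/-- M is horizontal at g for the parameter s̃: ⟨M, v_g⟩₁ = 0 for all v ∈ Im ℍ. -/
def Horizontal (s : ℝ) (g M : M2) : Prop :=
  ∀ v : ℍ[ℝ], v.re = 0 → mip1 s M (vmat g v) = 0

/-- Ad(a) : v ↦ a·v·a⁻¹ as an ℝ-linear endomorphism of ℍ. -/
def Ad (a : ℍ[ℝ]) : ℍ[ℝ] →ₗ[ℝ] ℍ[ℝ] where
  toFun v := a * v * a⁻¹
  map_add' u v := by simp [mul_add, add_mul]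
  map_smul' r v := by simp [mul_smul_comm, smul_mul_assoc]

/-- D(a,b) = det(id − Ad(a⁻¹) − Ad(b⁻¹)) on ℍ. -/
def Dd (a b : ℍ[ℝ]) : ℝ := LinearMap.det (LinearMap.id - Ad a⁻¹ - Ad b⁻¹)

/-- h-part of a 2×2 matrix. -/
def Hpart (A : M2) : M2 := dg ((A 0 0 + A 1 1) / 2) ((A 0 0 + A 1 1) / 2)

/-- q-part of a 2×2 matrix. -/
def Qpart (A : M2) : M2 := dg ((A 0 0 - A 1 1) / 2) ((A 1 1 - A 0 0) / 2)

/-- X̃ = X_p + X_q + t̃•X_h. -/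
def tdX (t : ℝ) (A : M2) : M2 := Ppart A + Qpart A + t • Hpart A

/-- X̃_k = X_q + t̃•X_h. -/
def tdK (t : ℝ) (A : M2) : M2 := Qpart A + t • Hpart A

/-- Commutator of 2×2 quaternionic matrices. -/
def br (A B : M2) : M2 := A * B - B * A

/-- The matrix with diagonal `(x, y)`, upper right entry `p` and lower left entry `-p̄`. -/
def skewMat (x y p : ℍ[ℝ]) : M2 := !![x, p; -star p, y]

/-- The functional whose vanishing expresses horizontality of `skewMat x y p` at a matrix with
first row `(a, b)`. -/
def horizontalDefect (s : ℝ) (a b x y p : ℍ[ℝ]) : ℍ[ℝ] :=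
  (2 : ℝ) • (a * p * star b).im + s • (a * x * star a + b * y * star b - x - y)

theorem qip_eq (x y : ℍ[ℝ]) :
    qip x y = x.re * y.re + x.imI * y.imI + x.imJ * y.imJ + x.imK * y.imK := by
  simp [qip]

theorem qip_self_eq_zero {x : ℍ[ℝ]} : qip x x = 0 ↔ x = 0 := by
  rw [← Quaternion.normSq_eq_zero, Quaternion.normSq_def', qip_eq]
  ring_nf

theorem re_conj_mul (a x : ℍ[ℝ]) : (a * x * star a).re = Quaternion.normSq a * x.re := by
  simp [Quaternion.normSq_def']
  ring

theorem horizontalDefect_re (s : ℝ) (a b p : ℍ[ℝ]) {x y : ℍ[ℝ]} (hx : x.re = 0) (hy : y.re = 0) :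
    (horizontalDefect s a b x y p).re = 0 := by
  simp [horizontalDefect, re_conj_mul, hx, hy, -Quaternion.re_mul]

theorem mip1_vmat (s : ℝ) (g : M2) (x y p v : ℍ[ℝ]) (hv : v.re = 0) :
    mip1 s (skewMat x y p) (vmat g v) = qip (horizontalDefect s (g 0 0) (g 0 1) x y p) v := by
  simp [mip1, mip, Ppart, Kpart, dg, skewMat, vmat, Matrix.trace, Fin.sum_univ_two, Matrix.mul_apply,
    horizontalDefect, qip_eq, hv]
  ring

theorem horizontal_skewMat_iff (s : ℝ) (g : M2) (p : ℍ[ℝ]) {x y : ℍ[ℝ]} (hx : x.re = 0)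
    (hy : y.re = 0) :
    Horizontal s g (skewMat x y p) ↔ horizontalDefect s (g 0 0) (g 0 1) x y p = 0 := by
  constructor
  · intro h
    have h1 := horizontalDefect_re s (g 0 0) (g 0 1) p hx hy
    rw [← qip_self_eq_zero, ← mip1_vmat s g x y p _ h1]
    exact h _ h1
  · intro h v hv
    rw [mip1_vmat s g x y p v hv, h]
    simp [qip]

theorem exists_skewMat_of_skew {X : M2} (hX : Xᴴ = -X) :
    ∃ q h p : ℍ[ℝ], q.re = 0 ∧ h.re = 0 ∧ X = skewMat (h + q) (h - q) p := by
  have hX' := Matrix.ext_iff.mpr hX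
  simp only [Fin.forall_fin_two, Fin.isValue, Matrix.conjTranspose_apply, Matrix.neg_apply,
    Quaternion.star_eq_neg] at hX'
  obtain ⟨⟨h00, -⟩, h10, h11⟩ := hX'
  refine ⟨(1 / 2 : ℝ) • (X 0 0 - X 1 1), (1 / 2 : ℝ) • (X 0 0 + X 1 1), X 0 1, by simp [h00, h11],
    by simp [h00, h11], ?_⟩
  ext i j : 1
  fin_cases i <;> fin_cases j
  · simp [skewMat]; module
  · simp [skewMat]
  · simp [skewMat, h10]
  · simp [skewMat]; module

theorem skewMat_conjTranspose {x y : ℍ[ℝ]} (p : ℍ[ℝ]) (hx : x.re = 0) (hy : y.re = 0) :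
    (skewMat x y p)ᴴ = -skewMat x y p := by
  rw [← Quaternion.star_eq_neg] at hx hy
  ext i j : 1
  fin_cases i <;> fin_cases j <;> simp [skewMat, hx, hy]

theorem Ppart_skewMat (x y p : ℍ[ℝ]) : Ppart (skewMat x y p) = skewMat 0 0 p := by
  ext i j : 1
  fin_cases i <;> fin_cases j <;> simp [skewMat, Ppart, Kpart, dg]

theorem div_two_eq_smul (x : ℍ[ℝ]) : x / 2 = (1 / 2 : ℝ) • x := by
  have : CharZero ℍ[ℝ] := algebraRat.charZero _
  rw [div_eq_iff two_ne_zero, mul_two]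
  module

theorem Qpart_skewMat (q h p : ℍ[ℝ]) : Qpart (skewMat (h + q) (h - q) p) = dg q (-q) := by
  simp only [Qpart, skewMat, div_two_eq_smul]
  ext i j : 1
  fin_cases i <;> fin_cases j <;> simp [dg] <;> module

theorem Hpart_skewMat (q h p : ℍ[ℝ]) : Hpart (skewMat (h + q) (h - q) p) = dg h h := by
  simp only [Hpart, skewMat, div_two_eq_smul]
  ext i j : 1
  fin_cases i <;> fin_cases j <;> simp [dg] <;> module

theorem tdK_skewMat (t : ℝ) (q h p : ℍ[ℝ]) :
    tdK t (skewMat (h + q) (h - q) p) = dg (t • h + q) (t • h - q) := by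
  rw [tdK, Qpart_skewMat, Hpart_skewMat]
  ext i j : 1
  fin_cases i <;> fin_cases j <;> simp [dg] <;> module

theorem tdX_skewMat (t : ℝ) (q h p : ℍ[ℝ]) :
    tdX t (skewMat (h + q) (h - q) p) = skewMat (t • h + q) (t • h - q) p := by
  rw [tdX, Qpart_skewMat, Hpart_skewMat, Ppart_skewMat]
  ext i j : 1
  fin_cases i <;> fin_cases j <;> simp [dg, skewMat] <;> module

theorem br_dg_eq_zero_iff (x y x' y' : ℍ[ℝ]) :
    br (dg x y) (dg x' y') = 0 ↔ x * x' = x' * x ∧ y * y' = y' * y := by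
  rw [br, sub_eq_zero, ← Matrix.ext_iff]
  simp [Fin.forall_fin_two, dg]

theorem br_skewMat_eq_zero_iff (x y p x' y' p' : ℍ[ℝ]) :
    br (skewMat x y p) (skewMat x' y' p') = 0 ↔
      (x * x' - p * star p' = x' * x - p' * star p ∧ x * p' + p * y' = x' * p + p' * y) ∧
      (star p * x' + y * star p' = star p' * x + y' * star p ∧
        y * y' - star p * p' = y' * y - star p' * p) := by
  rw [br, sub_eq_zero, ← Matrix.ext_iff]
  simp [Fin.forall_fin_two, skewMat, ← sub_eq_add_neg, ← neg_add', -neg_add_rev]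
  simp only [neg_add_eq_sub]
  tauto

theorem linearIndependent_skewMat_iff (x y p x' y' p' : ℍ[ℝ]) :
    LinearIndependent ℝ ![skewMat x y p, skewMat x' y' p'] ↔
      ∀ c d : ℝ, c • x + d • x' = 0 → c • y + d • y' = 0 → c • p + d • p' = 0 → c = 0 ∧ d = 0 := by
  rw [LinearIndependent.pair_iff]
  refine forall₂_congr fun c d => ?_
  rw [← Matrix.ext_iff]
  have hstar (h : c • p + d • p' = 0) : -(c • star p) + -(d • star p') = 0 := by
    simpa [Quaternion.star_smul, add_comm] using congrArg (fun z => -star z) h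
  simp [Fin.forall_fin_two, skewMat]
  tauto

theorem exists_horizontal_flat_iff (s : ℝ) {t : ℝ} (ht : t ≠ 0) (g : M2) :
    (∃ X Y : M2, Xᴴ = -X ∧ Yᴴ = -Y ∧
        LinearIndependent ℝ ![tdX t X, tdX t Y] ∧
        br (tdX t X) (tdX t Y) = 0 ∧
        br (tdK t X) (tdK t Y) = 0 ∧
        br (Ppart X) (Ppart Y) = 0 ∧
        br (Qpart X) (Qpart Y) = 0 ∧
        br (Hpart X) (Hpart Y) = 0 ∧
        Horizontal s g (tdX t X) ∧ Horizontal s g (tdX t Y)) ↔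
      ∃ x y p x' y' p' : ℍ[ℝ], (x.re = 0 ∧ y.re = 0 ∧ x'.re = 0 ∧ y'.re = 0) ∧
        (∀ c d : ℝ, c • x + d • x' = 0 → c • y + d • y' = 0 → c • p + d • p' = 0 →
          c = 0 ∧ d = 0) ∧
        x * x' = x' * x ∧ y * y' = y' * y ∧
        (x - y) * (x' - y') = (x' - y') * (x - y) ∧
        (x + y) * (x' + y') = (x' + y') * (x + y) ∧
        p * star p' = p' * star p ∧ star p * p' = star p' * p ∧
        x * p' + p * y' = x' * p + p' * y ∧
        horizontalDefect s (g 0 0) (g 0 1) x y p = 0 ∧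
        horizontalDefect s (g 0 0) (g 0 1) x' y' p' = 0 := by
  constructor
  · rintro ⟨X, Y, hX, hY, hli, hbr, hK, hP, hQ, hH, hhX, hhY⟩
    obtain ⟨q, h, p, hq, hh, rfl⟩ := exists_skewMat_of_skew hX
    obtain ⟨q', h', p', hq', hh', rfl⟩ := exists_skewMat_of_skew hY
    rw [tdX_skewMat] at hhX hhY
    rw [tdX_skewMat, tdX_skewMat] at hli hbr
    rw [tdK_skewMat, tdK_skewMat, br_dg_eq_zero_iff] at hK
    rw [Ppart_skewMat, Ppart_skewMat, br_skewMat_eq_zero_iff] at hP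
    rw [Qpart_skewMat, Qpart_skewMat, br_dg_eq_zero_iff] at hQ
    rw [Hpart_skewMat, Hpart_skewMat, br_dg_eq_zero_iff] at hH
    rw [linearIndependent_skewMat_iff] at hli
    rw [br_skewMat_eq_zero_iff] at hbr
    rw [horizontal_skewMat_iff _ _ _ (by simp [hq, hh]) (by simp [hq, hh])] at hhX
    rw [horizontal_skewMat_iff _ _ _ (by simp [hq', hh']) (by simp [hq', hh'])] at hhY
    refine ⟨_, _, p, _, _, p', ⟨?_, ?_, ?_, ?_⟩, hli, hK.1, hK.2, ?_, ?_, ?_, ?_, hbr.1.2, hhX, hhY⟩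
    · simp [hq, hh]
    · simp [hq, hh]
    · simp [hq', hh']
    · simp [hq', hh']
    · simp [← two_smul ℝ, hQ.1]
    · simp [← two_smul ℝ, hH.1]
    · simpa using hP.1.1
    · simpa using hP.2.2
  · rintro ⟨x, y, p, x', y', p', ⟨hx, hy, hx', hy'⟩, hli, hxx, hyy, hq, hh, hp, hp', hc, hX, hY⟩
    have hs := congrArg star hc
    simp only [star_add, star_mul, Quaternion.star_eq_neg.mpr hx, Quaternion.star_eq_neg.mpr hy,
      Quaternion.star_eq_neg.mpr hx', Quaternion.star_eq_neg.mpr hy', mul_neg, neg_mul, ← neg_add,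
      neg_inj] at hs
    have key {x y : ℍ[ℝ]} (hx : x.re = 0) (hy : y.re = 0) :
        ∃ q h : ℍ[ℝ], q.re = 0 ∧ h.re = 0 ∧ x = t • h + q ∧ y = t • h - q :=
      ⟨(1 / 2 : ℝ) • (x - y), (t⁻¹ / 2) • (x + y), by simp [hx, hy], by simp [hx, hy], by
        rw [smul_smul, mul_div_assoc', mul_inv_cancel₀ ht]; module, by
        rw [smul_smul, mul_div_assoc', mul_inv_cancel₀ ht]; module⟩
    obtain ⟨q, h, hq0, hh0, rfl, rfl⟩ := key hx hy
    obtain ⟨q', h', hq0', hh0', rfl, rfl⟩ := key hx' hy'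
    simp [← two_smul ℝ, smul_smul] at hq
    simp [← two_smul ℝ, smul_smul, ht] at hh
    refine ⟨skewMat (h + q) (h - q) p, skewMat (h' + q') (h' - q') p', ?_⟩
    rw [tdX_skewMat, tdX_skewMat, tdK_skewMat, tdK_skewMat, Ppart_skewMat, Ppart_skewMat,
      Qpart_skewMat, Qpart_skewMat, Hpart_skewMat, Hpart_skewMat, br_dg_eq_zero_iff,
      br_dg_eq_zero_iff, br_dg_eq_zero_iff, br_skewMat_eq_zero_iff, br_skewMat_eq_zero_iff,
      linearIndependent_skewMat_iff, horizontal_skewMat_iff _ _ _ hx hy,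
      horizontal_skewMat_iff _ _ _ hx' hy']
    refine ⟨?_, ?_, hli, ⟨⟨?_, hc⟩, ?_, ?_⟩, ⟨hxx, hyy⟩, by simp [hp, hp'], by simp [hq],
      by simp [hh], hX, hY⟩
    · exact skewMat_conjTranspose p (by simp [hq0, hh0]) (by simp [hq0, hh0])
    · exact skewMat_conjTranspose p' (by simp [hq0', hh0']) (by simp [hq0', hh0'])
    · rw [hxx, hp]
    · exact hs.symm
    · rw [hyy, hp']

theorem exists_eq_smul_of_mul_star_comm {p p' : ℍ[ℝ]} (hp : p ≠ 0)
    (h : p * star p' = p' * star p) : ∃ r : ℝ, p' = r • p := by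
  have h1 : star (p' * star p) = p' * star p := by rw [star_mul, star_star, h]
  rw [Quaternion.star_eq_self] at h1
  refine ⟨(Quaternion.normSq p)⁻¹ * (p' * star p).re, ?_⟩
  rw [mul_smul, eq_inv_smul_iff₀ (Quaternion.normSq_ne_zero.mpr hp), ← Quaternion.mul_coe_eq_smul,
    ← Quaternion.star_mul_self, ← mul_assoc, h1, Quaternion.coe_mul_eq_smul, Quaternion.re_coe]

theorem exists_eq_smul_of_comm {u v : ℍ[ℝ]} (hu : u.re = 0) (hv : v.re = 0) (hu0 : u ≠ 0)
    (h : u * v = v * u) : ∃ r : ℝ, v = r • u := by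
  refine exists_eq_smul_of_mul_star_comm hu0 ?_
  rw [Quaternion.star_eq_neg.mpr hu, Quaternion.star_eq_neg.mpr hv, mul_neg, mul_neg, h]

theorem mul_add_mul_comm_of_re_eq_zero (z : ℍ[ℝ]) {w : ℍ[ℝ]} (hw : w.re = 0) :
    z * w + w * z = (2 * z.re) • w - ((2 * qip z w : ℝ) : ℍ[ℝ]) := by
  ext <;> simp [qip_eq, hw] <;> ring

theorem mul_eq_neg_mul_of_qip_eq_zero {z w : ℍ[ℝ]} (hz : z.re = 0) (hw : w.re = 0)
    (h : qip z w = 0) : z * w = -(w * z) := by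
  rw [eq_neg_iff_add_eq_zero, mul_add_mul_comm_of_re_eq_zero z hw, hz, h]
  simp

theorem re_eq_zero_and_qip_eq_zero {z w : ℍ[ℝ]} (hw : w.re = 0) (hw0 : w ≠ 0)
    (h : z * w = -(w * z)) : z.re = 0 ∧ qip z w = 0 := by
  rw [eq_neg_iff_add_eq_zero, mul_add_mul_comm_of_re_eq_zero z hw] at h
  have h1 : qip z w = 0 := by simpa [hw] using congrArg QuaternionAlgebra.re h
  exact ⟨by simpa [h1, hw0] using h, h1⟩

theorem qip_self (x : ℍ[ℝ]) : qip x x = Quaternion.normSq x := by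
  rw [Quaternion.normSq_def', qip_eq]
  ring

theorem normSq_sub_eq (x y : ℍ[ℝ]) : Quaternion.normSq (x - y) =
    Quaternion.normSq x + Quaternion.normSq y - 2 * qip x y := by
  simp [Quaternion.normSq_def', qip_eq]
  ring

theorem normSq_conj (a x : ℍ[ℝ]) : Quaternion.normSq (a * x * star a) =
    Quaternion.normSq a ^ 2 * Quaternion.normSq x := by
  simp only [map_mul, Quaternion.normSq_star]
  ring

theorem qip_conj_conj (a x y : ℍ[ℝ]) :
    qip (a * x * star a) (a * y * star a) = Quaternion.normSq a ^ 2 * qip x y := by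
  simp [Quaternion.normSq_def', qip_eq]
  ring

theorem qip_conj_self (a : ℍ[ℝ]) {w : ℍ[ℝ]} (hw : w.re = 0) : qip (a * w * star a) w =
    (Quaternion.normSq a - 2 * Quaternion.normSq a.im) * Quaternion.normSq w
      + 2 * qip a.im w ^ 2 := by
  simp [Quaternion.normSq_def', qip_eq, hw]
  ring

theorem exists_imaginary_orthogonal (u : ℍ[ℝ]) : ∃ v : ℍ[ℝ], v.re = 0 ∧ v ≠ 0 ∧ qip u v = 0 := by
  by_cases h : u.imI = 0
  · exact ⟨⟨0, 1, 0, 0⟩, rfl, fun h' => one_ne_zero (congrArg QuaternionAlgebra.imI h'),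
      (qip_eq _ _).trans (by simp [h])⟩
  · exact ⟨⟨0, -u.imJ, u.imI, 0⟩, rfl, fun h' => h (congrArg QuaternionAlgebra.imJ h'),
      (qip_eq _ _).trans (by simp; ring)⟩

/-- Conjugation by `a` rotates some imaginary vector by exactly `π / 3` iff `|a| ≤ 2 |Im a|`. -/
theorem exists_rotation_half_iff {a : ℍ[ℝ]} (ha : a ≠ 0) :
    (∃ w : ℍ[ℝ], w.re = 0 ∧ w ≠ 0 ∧
      2 * qip (a * w * star a) w = Quaternion.normSq a * Quaternion.normSq w) ↔
    Quaternion.normSq a ≤ 4 * Quaternion.normSq a.im := by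
  have ha' := Quaternion.normSq_ne_zero.mpr ha
  constructor
  · rintro ⟨w, hw, hw0, h⟩
    rw [qip_conj_self a hw] at h
    have hpos := (Quaternion.normSq_nonneg (a := w)).lt_of_ne'
      (Quaternion.normSq_ne_zero.mpr hw0)
    refine le_of_mul_le_mul_right ?_ hpos
    nlinarith [sq_nonneg (qip a.im w)]
  · intro h
    obtain ⟨u, hu, hu0, hau⟩ := exists_imaginary_orthogonal a.im
    have hu0' := Quaternion.normSq_ne_zero.mpr hu0
    have hle : Quaternion.normSq a.im ≤ Quaternion.normSq a := by
      simp [Quaternion.normSq_def', sq_nonneg]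
    set N := Quaternion.normSq a.im with hN
    set U := Quaternion.normSq u with hU
    have hUn : 0 ≤ U := Quaternion.normSq_nonneg
    have hNn : 0 ≤ N := Quaternion.normSq_nonneg
    have hN0 : N ≠ 0 := fun h0 => ha' (le_antisymm (by linarith) Quaternion.normSq_nonneg)
    set k := (4 * N - Quaternion.normSq a) / 4 with hk
    have hk0 : 0 ≤ k := by linarith
    have hk1 : 0 ≤ N - k := by linarith
    have hw : Quaternion.normSq ((√k * √U) • a.im + (√(N - k) * √N) • u) = U * N ^ 2 := by
      have : ∀ c d : ℝ, Quaternion.normSq (c • a.im + d • u) =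
          c ^ 2 * N + d ^ 2 * U + 2 * c * d * qip a.im u := by
        intro c d
        simp [hN, hU, Quaternion.normSq_def', qip_eq]
        ring
      rw [this, hau, mul_pow, mul_pow, Real.sq_sqrt hk0, Real.sq_sqrt hk1, Real.sq_sqrt hUn,
        Real.sq_sqrt hNn]
      ring
    have hq : qip a.im ((√k * √U) • a.im + (√(N - k) * √N) • u) ^ 2 = k * U * N ^ 2 := by
      have : ∀ c d : ℝ, qip a.im (c • a.im + d • u) = c * N + d * qip a.im u := by
        intro c d
        simp [hN, Quaternion.normSq_def', qip_eq]
        ring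
      rw [this, hau, mul_zero, add_zero, mul_pow, mul_pow, Real.sq_sqrt hk0, Real.sq_sqrt hUn]
    have hre : ((√k * √U) • a.im + (√(N - k) * √N) • u).re = 0 := by simp [hu]
    refine ⟨(√k * √U) • a.im + (√(N - k) * √N) • u, hre, ?_, ?_⟩
    · rw [← Quaternion.normSq_ne_zero, hw]
      positivity
    · rw [qip_conj_self a hre, hw, hq, hk]
      ring

theorem norm_im_ge_half_iff (a : ℍ[ℝ]) :
    ‖a.im‖ ≥ ‖a‖ / 2 ↔ Quaternion.normSq a ≤ 4 * Quaternion.normSq a.im := by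
  rw [Quaternion.normSq_eq_norm_mul_self, Quaternion.normSq_eq_norm_mul_self, ge_iff_le,
    div_le_iff₀ two_pos, mul_self_le_mul_self_iff (norm_nonneg _) (by positivity)]
  ring_nf

theorem Sp2.normSq_row {g : M2} (hg : Sp2 g) :
    Quaternion.normSq (g 0 0) + Quaternion.normSq (g 0 1) = 1 := by
  have h := Matrix.ext_iff.mpr hg
  simp [Fin.forall_fin_two, Matrix.mul_apply, Fin.sum_univ_two, Quaternion.star_mul_self] at h
  obtain ⟨⟨h00, h01⟩, -, h11⟩ := h
  have h00' : Quaternion.normSq (g 0 0) + Quaternion.normSq (g 1 0) = 1 :=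
    Quaternion.coe_injective (by push_cast; exact h00)
  have h11' : Quaternion.normSq (g 0 1) + Quaternion.normSq (g 1 1) = 1 :=
    Quaternion.coe_injective (by push_cast; exact h11)
  have h := congrArg Quaternion.normSq (eq_neg_of_add_eq_zero_left h01)
  simp only [map_mul, Quaternion.normSq_neg, Quaternion.normSq_star] at h
  rw [← eq_sub_iff_add_eq'] at h00' h11'
  rw [h00', h11'] at h
  linarith

theorem Dd_eq_zero_iff {a b : ℍ[ℝ]} :
    Dd a b = 0 ↔ ∃ v : ℍ[ℝ], v ≠ 0 ∧ v = a⁻¹ * v * a + b⁻¹ * v * b := by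
  rw [Dd, LinearMap.det_eq_zero_iff_ker_ne_bot, Submodule.ne_bot_iff]
  refine exists_congr fun v => ?_
  simp [Ad, sub_sub, sub_eq_zero, and_comm]

theorem mul_self_of_re_eq_zero {x : ℍ[ℝ]} (hx : x.re = 0) :
    x * x = -((Quaternion.normSq x : ℝ) : ℍ[ℝ]) := by
  rw [← Quaternion.self_mul_star, Quaternion.star_eq_neg.mpr hx, mul_neg, neg_neg]

theorem exists_conj_eq_add_iff {a : ℍ[ℝ]} (ha : Quaternion.normSq a = 1) :
    (∃ x y : ℍ[ℝ], x.re = 0 ∧ y.re = 0 ∧ x ≠ 0 ∧ Quaternion.normSq x = Quaternion.normSq y ∧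
      a * x * star a = x + y) ↔ Quaternion.normSq a ≤ 4 * Quaternion.normSq a.im := by
  rw [← exists_rotation_half_iff (Quaternion.normSq_ne_zero.mp (ha ▸ one_ne_zero))]
  refine exists_congr fun x => ⟨?_, ?_⟩
  · rintro ⟨y, hx, -, hx0, hxy, h⟩
    refine ⟨hx, hx0, ?_⟩
    rw [← sub_eq_iff_eq_add'] at h
    rw [← h, normSq_sub_eq, normSq_conj] at hxy
    rw [ha] at hxy ⊢
    linarith
  · rintro ⟨hx, hx0, h⟩
    refine ⟨a * x * star a - x, hx, ?_, hx0, ?_, by abel⟩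
    · rw [Quaternion.re_sub, re_conj_mul, hx, mul_zero, sub_zero]
    · rw [normSq_sub_eq, normSq_conj, h, ha]
      ring

theorem mul_add_eq_add_mul_of_normSq_eq {x y : ℍ[ℝ]} (hx : x.re = 0) (hy : y.re = 0)
    (h : Quaternion.normSq x = Quaternion.normSq y) : x * (x + y) = (x + y) * y := by
  rw [mul_add, add_mul, mul_self_of_re_eq_zero hx, mul_self_of_re_eq_zero hy, h, add_comm]

theorem star_eq_normSq_smul_inv (a : ℍ[ℝ]) : star a = Quaternion.normSq a • a⁻¹ := by
  rcases eq_or_ne a 0 with rfl | ha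
  · simp
  · rw [← Quaternion.coe_mul_eq_smul, ← Quaternion.star_mul_self, mul_inv_cancel_right₀ ha]

theorem re_inv_mul_mul {a : ℍ[ℝ]} (ha : a ≠ 0) (v : ℍ[ℝ]) : (a⁻¹ * v * a).re = v.re := by
  have hcomm (x y : ℍ[ℝ]) : (x * y).re = (y * x).re := by simp; ring
  rw [hcomm, ← mul_assoc, mul_inv_cancel₀ ha, one_mul]

/-- Solvability of the horizontality equations for a flat plane spanned by an element of `𝔭` and an
element of `𝔨`. -/
theorem exists_split_plane_iff {a b : ℍ[ℝ]}
    (hab : Quaternion.normSq a + Quaternion.normSq b = 1) :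
    (∃ x y p : ℍ[ℝ], x.re = 0 ∧ y.re = 0 ∧ x ≠ 0 ∧ p ≠ 0 ∧ x * p = p * y ∧
      (a * p * star b).im = 0 ∧ a * x * star a + b * y * star b = x + y) ↔
    (a ≠ 0 ∧ b ≠ 0 ∧ Dd a b = 0) ∨
      (b = 0 ∧ Quaternion.normSq a ≤ 4 * Quaternion.normSq a.im) ∨
      (a = 0 ∧ Quaternion.normSq b ≤ 4 * Quaternion.normSq b.im) := by
  constructor
  · rintro ⟨x, y, p, hx, hy, hx0, hp0, hxy, hp, h⟩
    have hN : Quaternion.normSq x = Quaternion.normSq y := by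
      have := congrArg Quaternion.normSq hxy
      rw [map_mul, map_mul, mul_comm] at this
      exact mul_left_cancel₀ (Quaternion.normSq_ne_zero.mpr hp0) this
    have hy0 : y ≠ 0 := by rwa [← Quaternion.normSq_ne_zero, ← hN, Quaternion.normSq_ne_zero]
    by_cases hb : b = 0
    · subst hb
      refine .inr (.inl ⟨rfl, (exists_conj_eq_add_iff (by simpa using hab)).mp ?_⟩)
      exact ⟨x, y, hx, hy, hx0, hN, by simpa using h⟩
    by_cases ha : a = 0
    · subst ha
      refine .inr (.inr ⟨rfl, (exists_conj_eq_add_iff (by simpa using hab)).mp ?_⟩)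
      exact ⟨y, x, hy, hx, hy0, hN.symm, by simpa [add_comm] using h⟩
    refine .inl ⟨ha, hb, Dd_eq_zero_iff.mpr ⟨a * x * a⁻¹, by simp [ha, hx0], ?_⟩⟩
    have hpr : a * p * star b = ((a * p * star b).re : ℍ[ℝ]) := by
      conv_lhs => rw [← Quaternion.re_add_im (a * p * star b), hp, add_zero]
    have hr0 : (a * p * star b).re ≠ 0 := by
      intro h0
      rw [h0] at hpr
      simp [ha, hb, hp0] at hpr
    set r := (a * p * star b).re
    have hrb : r • b = Quaternion.normSq b • (a * p) := by
      rw [← Quaternion.coe_mul_eq_smul, ← hpr, mul_assoc, Quaternion.star_mul_self,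
        Quaternion.mul_coe_eq_smul]
    have hby : a * x * a⁻¹ * b = b * y := by
      refine smul_right_injective _ hr0 ?_
      simp only
      rw [← mul_smul_comm, ← smul_mul_assoc, hrb, mul_smul_comm, smul_mul_assoc, mul_assoc a p,
        ← hxy, mul_assoc (a * x), inv_mul_cancel_left₀ ha, mul_assoc]
    rw [mul_assoc b⁻¹, hby, inv_mul_cancel_left₀ hb, mul_assoc a⁻¹, inv_mul_cancel_right₀ ha,
      inv_mul_cancel_left₀ ha, ← h, ← hby, star_eq_normSq_smul_inv a, star_eq_normSq_smul_inv b,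
      mul_smul_comm, mul_smul_comm, mul_inv_cancel_right₀ hb, ← add_smul, hab, one_smul]
  · rintro (⟨ha, hb, h⟩ | ⟨rfl, h⟩ | ⟨rfl, h⟩)
    · obtain ⟨v, hv0, hv⟩ := Dd_eq_zero_iff.mp h
      have hv1 : v.re = 0 := by
        have := congrArg QuaternionAlgebra.re hv
        rw [Quaternion.re_add, re_inv_mul_mul ha, re_inv_mul_mul hb] at this
        linarith
      refine ⟨a⁻¹ * v * a, b⁻¹ * v * b, a⁻¹ * b, ?_, ?_, by simp [ha, hv0], by simp [ha, hb], ?_,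
        ?_, ?_⟩
      · rw [re_inv_mul_mul ha, hv1]
      · rw [re_inv_mul_mul hb, hv1]
      · simp [mul_assoc, ha, hb]
      · simp [ha, Quaternion.self_mul_star]
      · rw [← hv, star_eq_normSq_smul_inv a, star_eq_normSq_smul_inv b, mul_smul_comm,
          mul_smul_comm, mul_assoc a⁻¹, mul_assoc b⁻¹, mul_inv_cancel_left₀ ha,
          mul_inv_cancel_left₀ hb, mul_inv_cancel_right₀ ha, mul_inv_cancel_right₀ hb, ← add_smul,
          hab, one_smul]
    · have ha : Quaternion.normSq a = 1 := by simpa using hab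
      obtain ⟨x, y, hx, hy, hx0, hN, he⟩ := (exists_conj_eq_add_iff ha).mpr h
      refine ⟨x, y, x + y, hx, hy, hx0, ?_, mul_add_eq_add_mul_of_normSq_eq hx hy hN, by simp,
        by simpa using he⟩
      rw [← he, ← Quaternion.normSq_ne_zero, normSq_conj, ha]
      simpa using hx0
    · have hb : Quaternion.normSq b = 1 := by simpa using hab
      obtain ⟨y, x, hy, hx, hy0, hN, he⟩ := (exists_conj_eq_add_iff hb).mpr h
      refine ⟨x, y, x + y, hx, hy, ?_, ?_, mul_add_eq_add_mul_of_normSq_eq hx hy hN.symm, by simp,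
        by simpa [add_comm] using he⟩
      · rwa [← Quaternion.normSq_ne_zero, ← hN, Quaternion.normSq_ne_zero]
      rw [add_comm, ← he, ← Quaternion.normSq_ne_zero, normSq_conj, hb]
      simpa using hy0

theorem qip_inv_conj_eq_zero_iff {a : ℍ[ℝ]} (ha : Quaternion.normSq a = 1 / 2) (u : ℍ[ℝ]) :
    qip (u - 2 * (a⁻¹ * u * a)) u = 0 ↔
      2 * qip (a * u * star a) u = Quaternion.normSq a * Quaternion.normSq u := by
  have h1 : a⁻¹ = (2 : ℝ) • star a := by
    rw [star_eq_normSq_smul_inv, ha, smul_smul]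
    norm_num
  have h2 : qip (u - 2 * (a⁻¹ * u * a)) u =
      Quaternion.normSq u - 4 * qip (a * u * star a) u := by
    rw [h1, two_mul, ← two_smul ℝ]
    simp [Quaternion.normSq_def', qip_eq]
    ring
  rw [h2, ha]
  constructor <;> intro h <;> linarith

theorem mul_comm_of_im_mul_comm {c w : ℍ[ℝ]} (h : c.im * w = w * c.im) : c * w = w * c := by
  rw [← Quaternion.re_add_im c, add_mul, mul_add, h, Quaternion.coe_commutes]

theorem im_mul_comm_of_mul_comm {c w : ℍ[ℝ]} (h : c * w = w * c) : c.im * w = w * c.im := by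
  rwa [← Quaternion.re_add_im c, add_mul, mul_add, Quaternion.coe_commutes, add_right_inj] at h

theorem im_eq_self {x : ℍ[ℝ]} (hx : x.re = 0) : x.im = x := by
  conv_rhs => rw [← Quaternion.re_add_im x, hx, Quaternion.coe_zero, zero_add]

theorem eq_zero_of_conj_eq_zero {a z : ℍ[ℝ]} (ha : a ≠ 0) (h : a * z * star a = 0) : z = 0 := by
  simpa [ha] using h

/-- Solvability of the horizontality equations for a flat plane whose `𝔨`-components are all
multiples of one imaginary quaternion. -/
theorem exists_rotated_plane_iff {a b : ℍ[ℝ]}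
    (hab : Quaternion.normSq a + Quaternion.normSq b = 1) :
    (∃ (w p : ℍ[ℝ]) (δ : ℝ), w.re = 0 ∧ w ≠ 0 ∧ p ≠ 0 ∧ w * p = -(p * w) ∧
      a * w * star a = b * w * star b ∧ (a * p * star b).im = δ • (w - a * w * star a)) ↔
    ‖a‖ = ‖b‖ ∧ qip ((a⁻¹ * b).im - 2 * (a⁻¹ * (a⁻¹ * b).im * a)) (a⁻¹ * b).im = 0 ∧
      Quaternion.normSq a ≤ 4 * Quaternion.normSq a.im := by
  have hnorm : ‖a‖ = ‖b‖ ↔ Quaternion.normSq a = Quaternion.normSq b := by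
    rw [Quaternion.normSq_eq_norm_mul_self, Quaternion.normSq_eq_norm_mul_self,
      mul_self_inj (norm_nonneg _) (norm_nonneg _)]
  rw [hnorm]
  have setup (hA : Quaternion.normSq a = Quaternion.normSq b) :
      Quaternion.normSq a = 1 / 2 ∧ a ≠ 0 ∧ ∃ c, a⁻¹ * b = c ∧ b = a * c ∧ c * star c = 1 ∧
        star c * c = 1 := by
    have ha : Quaternion.normSq a = 1 / 2 := by linarith
    have ha0 : a ≠ 0 := Quaternion.normSq_ne_zero.mp (by rw [ha]; norm_num)
    refine ⟨ha, ha0, _, rfl, by rw [mul_inv_cancel_left₀ ha0], ?_, ?_⟩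
    · rw [Quaternion.self_mul_star, map_mul, Quaternion.normSq_inv, ← hA, ha]
      norm_num
    · rw [Quaternion.star_mul_self, map_mul, Quaternion.normSq_inv, ← hA, ha]
      norm_num
  constructor
  · rintro ⟨w, p, δ, hw, hw0, hp0, hwp, hawb, him⟩
    have hw0' := Quaternion.normSq_ne_zero.mpr hw0
    have hA : Quaternion.normSq a = Quaternion.normSq b := by
      have := congrArg Quaternion.normSq hawb
      rw [normSq_conj, normSq_conj] at this
      exact (pow_left_inj₀ Quaternion.normSq_nonneg Quaternion.normSq_nonneg two_ne_zero).mp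
        (mul_right_cancel₀ hw0' this)
    obtain ⟨ha, ha0, c, hc, rfl, hcc, hcc'⟩ := setup hA
    have hcw : c * w = w * c := by
      have h0 : a * (w - c * w * star c) * star a = 0 := by
        rw [mul_sub, sub_mul, hawb, star_mul]
        simp only [mul_assoc, sub_self]
      have h1 := sub_eq_zero.mp (eq_zero_of_conj_eq_zero ha0 h0)
      have h2 := congrArg (· * c) h1
      simp only [mul_assoc, hcc', mul_one] at h2
      exact h2.symm
    have hcw' : star c * w = w * star c := by
      have h1 := congrArg star hcw
      rw [star_mul, star_mul, Quaternion.star_eq_neg.mpr hw, neg_mul, mul_neg, neg_inj] at h1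
      exact h1.symm
    have hz0 : p * star c ≠ 0 := by
      intro h0
      have h1 := congrArg (· * c) h0
      simp only [mul_assoc, hcc', mul_one, zero_mul] at h1
      exact hp0 h1
    have hzw : p * star c * w = -(w * (p * star c)) := by
      rw [mul_assoc, hcw', ← mul_assoc, ← mul_assoc, hwp, neg_mul, neg_neg]
    obtain ⟨hz, hzq⟩ := re_eq_zero_and_qip_eq_zero hw hw0 hzw
    have haz : a * (p * star c) * star a = δ • (w - a * w * star a) := by
      rw [← him, star_mul, ← im_eq_self (x := a * (p * star c) * star a)
        (by rw [re_conj_mul, hz, mul_zero])]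
      simp only [mul_assoc]
    have hδ : δ ≠ 0 := by
      rintro rfl
      rw [zero_smul] at haz
      exact hz0 (eq_zero_of_conj_eq_zero ha0 haz)
    have hhalf : 2 * qip (a * w * star a) w = Quaternion.normSq a * Quaternion.normSq w := by
      have h1 := qip_conj_conj a (p * star c) w
      have h2 : ∀ x y : ℍ[ℝ], qip (δ • (x - y)) y = δ * (qip y x - Quaternion.normSq y) := by
        intro x y
        simp [Quaternion.normSq_def', qip_eq]
        ring
      rw [haz, h2, hzq, mul_zero, mul_eq_zero, or_iff_right hδ, normSq_conj] at h1
      rw [sub_eq_zero.mp h1, ha]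
      ring
    refine ⟨hA, ?_, (exists_rotation_half_iff ha0).mp ⟨w, hw, hw0, hhalf⟩⟩
    obtain ⟨r, hr⟩ := exists_eq_smul_of_comm hw (Quaternion.re_im c) hw0
      (im_mul_comm_of_mul_comm hcw).symm
    rw [qip_inv_conj_eq_zero_iff ha, hc, hr, Quaternion.normSq_smul, mul_smul_comm, smul_mul_assoc]
    have : ∀ x y : ℍ[ℝ], qip (r • x) (r • y) = r ^ 2 * qip x y := by
      intro x y
      simp [qip_eq]
      ring
    rw [this]
    linear_combination r ^ 2 * hhalf
  · rintro ⟨hA, hq, hle⟩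
    obtain ⟨ha, ha0, c, hc, rfl, hcc, hcc'⟩ := setup hA
    rw [hc, qip_inv_conj_eq_zero_iff ha] at hq
    obtain ⟨w, hw, hw0, hhalf, hcw⟩ : ∃ w : ℍ[ℝ], w.re = 0 ∧ w ≠ 0 ∧
        2 * qip (a * w * star a) w = Quaternion.normSq a * Quaternion.normSq w ∧
        c * w = w * c := by
      by_cases h0 : c.im = 0
      · obtain ⟨w, hw, hw0, hhalf⟩ := (exists_rotation_half_iff ha0).mpr hle
        exact ⟨w, hw, hw0, hhalf, mul_comm_of_im_mul_comm (by simp [h0])⟩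
      · exact ⟨c.im, Quaternion.re_im c, h0, hq, mul_comm_of_im_mul_comm rfl⟩
    have hw0' := Quaternion.normSq_ne_zero.mpr hw0
    set z := (2 : ℝ) • (a⁻¹ * w * a) - w with hz
    have haz : a * z * star a = w - a * w * star a := by
      rw [hz, mul_sub, sub_mul, mul_smul_comm, smul_mul_assoc, mul_assoc a⁻¹,
        mul_inv_cancel_left₀ ha0, mul_assoc w, Quaternion.self_mul_star, ha,
        Quaternion.mul_coe_eq_smul, smul_smul]
      norm_num
    have hzre : z.re = 0 := by
      rw [hz, Quaternion.re_sub, Quaternion.re_smul, re_inv_mul_mul ha0, hw]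
      simp
    have hzq : qip z w = 0 := by
      have h1 : qip z w = -qip (w - 2 * (a⁻¹ * w * a)) w := by
        rw [hz, two_mul, ← two_smul ℝ]
        simp only [qip_eq, Quaternion.re_sub, Quaternion.imI_sub, Quaternion.imJ_sub,
          Quaternion.imK_sub]
        ring
      rw [h1, (qip_inv_conj_eq_zero_iff ha w).mpr hhalf, neg_zero]
    have hz0 : z ≠ 0 := by
      intro h0
      rw [h0, mul_zero, zero_mul, eq_comm, sub_eq_zero] at haz
      have := congrArg Quaternion.normSq haz
      rw [normSq_conj, ha] at this
      exact hw0' (by linarith)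
    have hc0 : c ≠ 0 := by
      rintro rfl
      simp at hcc
    refine ⟨w, z * c, 1, hw, hw0, mul_ne_zero hz0 hc0, ?_, ?_, ?_⟩
    · rw [mul_assoc, hcw, ← mul_assoc, ← mul_assoc,
        mul_eq_neg_mul_of_qip_eq_zero hzre hw hzq, neg_mul, neg_neg]
    · rw [star_mul, mul_assoc a c, hcw, ← mul_assoc a w, mul_assoc (a * w), ← mul_assoc c, hcc,
        one_mul]
    · rw [star_mul, one_smul, ← haz, ← mul_assoc a z, mul_assoc (a * z), ← mul_assoc c, hcc,
        one_mul, im_eq_self (by rw [re_conj_mul, hzre, mul_zero])]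

theorem conj_add_conj_ne_two_smul {a b w : ℍ[ℝ]}
    (hab : Quaternion.normSq a + Quaternion.normSq b = 1) (hw0 : w ≠ 0) :
    a * w * star a + b * w * star b ≠ (2 : ℝ) • w := by
  intro h
  have h1 := norm_add_le (a * w * star a) (b * w * star b)
  rw [h, norm_smul, norm_mul, norm_mul, norm_mul, norm_mul, norm_star, norm_star] at h1
  rw [Quaternion.normSq_eq_norm_mul_self, Quaternion.normSq_eq_norm_mul_self] at hab
  have h2 : ‖a‖ * ‖w‖ * ‖a‖ + ‖b‖ * ‖w‖ * ‖b‖ = ‖w‖ := by linear_combination ‖w‖ * hab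
  rw [h2, Real.norm_two] at h1
  linarith [norm_pos_iff.mpr hw0]

theorem horizontalDefect_sub_smul (s r : ℝ) (a b x y p x' y' p' : ℍ[ℝ]) :
    horizontalDefect s a b (x - r • x') (y - r • y') (p - r • p') =
      horizontalDefect s a b x y p - r • horizontalDefect s a b x' y' p' := by
  simp only [horizontalDefect, mul_sub, sub_mul, mul_smul_comm, smul_mul_assoc, Quaternion.im_sub,
    Quaternion.im_smul]
  module

theorem split_or_rotated_of_flat {s : ℝ} (hs : s ≠ 0) {a b : ℍ[ℝ]}
    (hab : Quaternion.normSq a + Quaternion.normSq b = 1) {x y p x' y' : ℍ[ℝ]} (hx : x.re = 0)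
    (hy : y.re = 0) (hx' : x'.re = 0) (hy' : y'.re = 0) (hp : p ≠ 0) (h0 : x' = 0 → y' ≠ 0)
    (hxx : x * x' = x' * x) (hyy : y * y' = y' * y)
    (hq : (x - y) * (x' - y') = (x' - y') * (x - y)) (hc : x' * p = p * y')
    (hX : horizontalDefect s a b x y p = 0) (hY : horizontalDefect s a b x' y' 0 = 0) :
    (∃ x y p : ℍ[ℝ], x.re = 0 ∧ y.re = 0 ∧ x ≠ 0 ∧ p ≠ 0 ∧ x * p = p * y ∧
      (a * p * star b).im = 0 ∧ a * x * star a + b * y * star b = x + y) ∨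
    (∃ (w p : ℍ[ℝ]) (δ : ℝ), w.re = 0 ∧ w ≠ 0 ∧ p ≠ 0 ∧ w * p = -(p * w) ∧
      a * w * star a = b * w * star b ∧ (a * p * star b).im = δ • (w - a * w * star a)) := by
  have hx0 : x' ≠ 0 := by
    intro h
    rw [h, zero_mul, eq_comm, mul_eq_zero, or_iff_right hp] at hc
    exact h0 h hc
  have hy0 : y' ≠ 0 := by
    intro h
    rw [h, mul_zero, mul_eq_zero, or_iff_left hp] at hc
    exact hx0 hc
  have hE : a * x' * star a + b * y' * star b = x' + y' := by
    simp only [horizontalDefect, mul_zero, zero_mul, Quaternion.im_zero, smul_zero, zero_add,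
      smul_eq_zero, hs, false_or, sub_sub, sub_eq_zero] at hY
    exact hY
  obtain ⟨α, rfl⟩ := exists_eq_smul_of_comm hx' hx hx0 hxx.symm
  obtain ⟨β, rfl⟩ := exists_eq_smul_of_comm hy' hy hy0 hyy.symm
  have hX' : (2 : ℝ) • (a * p * star b).im = (s * (α - β)) • (x' - a * x' * star a) := by
    have h1 : b * y' * star b = x' + y' - a * x' * star a := by rw [← hE]; abel
    simp only [horizontalDefect, mul_smul_comm, smul_mul_assoc, h1] at hX
    rw [← sub_eq_zero, ← hX]
    module
  by_cases hαβ : α = β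
  · rw [hαβ, sub_self, mul_zero, zero_smul, smul_eq_zero, or_iff_right two_ne_zero] at hX'
    exact .inl ⟨x', y', p, hx', hy', hx0, hp, hc, hX', hE⟩
  have hcomm : x' * y' = y' * x' := by
    have h1 : (α - β) • (x' * y' - y' * x') = 0 := by
      simp only [mul_sub, sub_mul, mul_smul_comm, smul_mul_assoc] at hq
      rw [← sub_eq_zero] at hq
      rw [← neg_eq_zero, ← hq]
      module
    rwa [smul_eq_zero, or_iff_right (sub_ne_zero.mpr hαβ), sub_eq_zero] at h1
  obtain ⟨r, rfl⟩ := exists_eq_smul_of_comm hx' hy' hx0 hcomm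
  have hr : r * r = 1 := by
    have h1 := congrArg Quaternion.normSq hc
    rw [map_mul, map_mul, Quaternion.normSq_smul] at h1
    have h2 := mul_ne_zero (Quaternion.normSq_ne_zero.mpr hx0) (Quaternion.normSq_ne_zero.mpr hp)
    refine mul_right_cancel₀ h2 ?_
    linear_combination -h1
  rcases mul_self_eq_one_iff.mp hr with rfl | rfl
  · refine absurd ?_ (conj_add_conj_ne_two_smul hab hx0)
    rw [two_smul]
    simpa using hE
  · refine .inr ⟨x', p, s * (α - β) / 2, hx', hx0, hp, by simpa using hc, ?_, ?_⟩
    · simpa [← sub_eq_add_neg, sub_eq_zero] using hE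
    · rw [div_eq_inv_mul, mul_smul, ← hX', smul_smul]
      norm_num

theorem exists_combination_eq_zero {x x' : ℍ[ℝ]} (hx : x.re = 0) (hx' : x'.re = 0)
    (h : x * x' = x' * x) : ∃ c d : ℝ, ¬(c = 0 ∧ d = 0) ∧ c • x + d • x' = 0 := by
  by_cases hx0 : x = 0
  · exact ⟨1, 0, by simp, by simp [hx0]⟩
  · obtain ⟨r, rfl⟩ := exists_eq_smul_of_comm hx hx' hx0 h
    exact ⟨-r, 1, by simp, by module⟩

theorem normSq_eq_one_of_conj_eq {a u : ℍ[ℝ]} (hu : u ≠ 0) (h : a * u * star a = u) :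
    Quaternion.normSq a = 1 := by
  have h1 := congrArg Quaternion.normSq h
  rw [normSq_conj, mul_eq_right₀ (Quaternion.normSq_ne_zero.mpr hu)] at h1
  exact (pow_eq_one_iff_of_nonneg Quaternion.normSq_nonneg two_ne_zero).mp h1

theorem not_flat_of_diagonal {s : ℝ} (hs : s ≠ 0) {a b : ℍ[ℝ]}
    (hab : Quaternion.normSq a + Quaternion.normSq b = 1) {x y x' y' : ℍ[ℝ]} (hx : x.re = 0)
    (hy : y.re = 0) (hx' : x'.re = 0) (hy' : y'.re = 0)
    (hli : ∀ c d : ℝ, c • x + d • x' = 0 → c • y + d • y' = 0 → c = 0 ∧ d = 0)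
    (hxx : x * x' = x' * x) (hyy : y * y' = y' * y) (hX : horizontalDefect s a b x y 0 = 0)
    (hY : horizontalDefect s a b x' y' 0 = 0) : False := by
  simp only [horizontalDefect, mul_zero, zero_mul, Quaternion.im_zero, smul_zero, zero_add,
    smul_eq_zero, hs, false_or, sub_sub, sub_eq_zero] at hX hY
  have hE (c d : ℝ) : a * (c • x + d • x') * star a + b * (c • y + d • y') * star b =
      (c • x + d • x') + (c • y + d • y') := by
    calc _ = c • (a * x * star a + b * y * star b) + d • (a * x' * star a + b * y' * star b) := by
          simp only [mul_add, add_mul, mul_smul_comm, smul_mul_assoc]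
          module
      _ = _ := by
          rw [hX, hY]
          module
  have hb : Quaternion.normSq b = 1 := by
    obtain ⟨c, d, hcd, h⟩ := exists_combination_eq_zero hx hx' hxx
    exact normSq_eq_one_of_conj_eq (fun h' => hcd (hli c d h h')) (by simpa [h] using hE c d)
  have ha : Quaternion.normSq a = 1 := by
    obtain ⟨c, d, hcd, h⟩ := exists_combination_eq_zero hy hy' hyy
    exact normSq_eq_one_of_conj_eq (fun h' => hcd (hli c d h' h)) (by simpa [h] using hE c d)
  linarith

theorem exists_horizontalDefect_iff {s : ℝ} (hs : s ≠ 0) {a b : ℍ[ℝ]}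
    (hab : Quaternion.normSq a + Quaternion.normSq b = 1) :
    (∃ x y p x' y' p' : ℍ[ℝ], (x.re = 0 ∧ y.re = 0 ∧ x'.re = 0 ∧ y'.re = 0) ∧
        (∀ c d : ℝ, c • x + d • x' = 0 → c • y + d • y' = 0 → c • p + d • p' = 0 →
          c = 0 ∧ d = 0) ∧
        x * x' = x' * x ∧ y * y' = y' * y ∧
        (x - y) * (x' - y') = (x' - y') * (x - y) ∧
        (x + y) * (x' + y') = (x' + y') * (x + y) ∧
        p * star p' = p' * star p ∧ star p * p' = star p' * p ∧
        x * p' + p * y' = x' * p + p' * y ∧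
        horizontalDefect s a b x y p = 0 ∧ horizontalDefect s a b x' y' p' = 0) ↔
    (∃ x y p : ℍ[ℝ], x.re = 0 ∧ y.re = 0 ∧ x ≠ 0 ∧ p ≠ 0 ∧ x * p = p * y ∧
      (a * p * star b).im = 0 ∧ a * x * star a + b * y * star b = x + y) ∨
    (∃ (w p : ℍ[ℝ]) (δ : ℝ), w.re = 0 ∧ w ≠ 0 ∧ p ≠ 0 ∧ w * p = -(p * w) ∧
      a * w * star a = b * w * star b ∧ (a * p * star b).im = δ • (w - a * w * star a)) := by
  constructor
  · rintro ⟨x, y, p, x', y', p', ⟨hx, hy, hx', hy'⟩, hli, hxx, hyy, hq, -, hpp, -, hc, hX, hY⟩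
    by_cases hp : p = 0
    · subst hp
      by_cases hp' : p' = 0
      · subst hp'
        exact (not_flat_of_diagonal hs hab hx hy hx' hy' (by simpa using hli) hxx hyy hX hY).elim
      · refine split_or_rotated_of_flat hs hab hx' hy' hx hy hp' ?_ hxx.symm hyy.symm hq.symm
          (by simpa using hc) hY hX
        rintro rfl rfl
        simpa using hli 1 0
    · obtain ⟨r, rfl⟩ := exists_eq_smul_of_mul_star_comm hp hpp
      refine split_or_rotated_of_flat (x' := x' - r • x) (y' := y' - r • y) hs hab hx hy
        (by simp [hx, hx']) (by simp [hy, hy']) hp ?_ ?_ ?_ ?_ ?_ hX ?_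
      · intro h1 h2
        have := hli (-r) 1 (by rw [← h1]; module) (by rw [← h2]; module) (by module)
        exact one_ne_zero this.2
      · simp only [mul_sub, sub_mul, mul_smul_comm, smul_mul_assoc, hxx]
      · simp only [mul_sub, sub_mul, mul_smul_comm, smul_mul_assoc, hyy]
      · rw [show x' - r • x - (y' - r • y) = (x' - y') - r • (x - y) by module, mul_sub (x - y),
          sub_mul _ _ (x - y), hq, mul_smul_comm, smul_mul_assoc]
      · rw [← sub_eq_zero] at hc ⊢
        rw [← neg_eq_zero, ← hc]
        simp only [mul_sub, sub_mul, mul_smul_comm, smul_mul_assoc]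
        module
      · have := horizontalDefect_sub_smul s r a b x' y' (r • p) x y p
        rwa [hX, hY, sub_self, smul_zero, sub_self] at this
  · rintro (⟨x, y, p, hx, hy, hx0, hp, hc, him, hE⟩ | ⟨w, p, δ, hw, hw0, hp, hc, hE, him⟩)
    · refine ⟨0, 0, p, x, y, 0, ⟨rfl, rfl, hx, hy⟩, ?_, by simp, by simp, by simp, by simp, by simp,
        by simp, by simp [hc], by simp [horizontalDefect, him], ?_⟩
      · intro c d h1 h2 h3
        exact ⟨by simpa [hp] using h3, by simpa [hx0] using h1⟩
      · simp [horizontalDefect, hE]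
    · refine ⟨(δ / s) • w, (δ / s) • w, p, w, -w, 0, ⟨by simp [hw], by simp [hw], hw, by simp [hw]⟩,
        ?_, by simp, by simp, by simp, by simp, by simp, by simp, by simp [hc], ?_, ?_⟩
      · intro c d h1 h2 h3
        have hc0 : c = 0 := by simpa [hp] using h3
        exact ⟨hc0, by simpa [hw0, hc0] using h1⟩
      · simp only [horizontalDefect, him, mul_smul_comm, smul_mul_assoc, ← hE]
        simp only [← smul_add, ← smul_sub, smul_smul]
        rw [mul_div_cancel₀ _ hs]
        module
      · simp [horizontalDefect, hE]

/-- The main Theorem of the paper: there is a horizontal zero-curvature plane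
at g ∈ Sp(2) with first row (a,b) iff (a,b) satisfies one of the four
conditions describing π⁻¹Z₁, π⁻¹Z₂, π⁻¹Z₃, π⁻¹Z₄. -/
theorem stmt16 (s : ℝ) (hs0 : 0 < s) (hs1 : s < 1)
    (t : ℝ) (ht0 : 0 < t) (ht1 : t < 1)
    (g : M2) (hg : Sp2 g) (a b : ℍ[ℝ]) (ha : a = g 0 0) (hb : b = g 0 1) :
    (∃ X Y : M2, Xᴴ = -X ∧ Yᴴ = -Y ∧
        LinearIndependent ℝ ![tdX t X, tdX t Y] ∧
        br (tdX t X) (tdX t Y) = 0 ∧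
        br (tdK t X) (tdK t Y) = 0 ∧
        br (Ppart X) (Ppart Y) = 0 ∧
        br (Qpart X) (Qpart Y) = 0 ∧
        br (Hpart X) (Hpart Y) = 0 ∧
        Horizontal s g (tdX t X) ∧ Horizontal s g (tdX t Y)) ↔
      ((a ≠ 0 ∧ b ≠ 0 ∧ Dd a b = 0) ∨
       (‖a‖ = ‖b‖ ∧
          qip ((a⁻¹ * b).im - 2 * (a⁻¹ * (a⁻¹ * b).im * a)) (a⁻¹ * b).im = 0 ∧
          ‖a.im‖ ≥ ‖a‖ / 2) ∨
       (b = 0 ∧ ‖a.im‖ ≥ 1 / 2) ∨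
       (a = 0 ∧ ‖b.im‖ ≥ 1 / 2)) := by
  subst ha hb
  have hab := hg.normSq_row
  rw [exists_horizontal_flat_iff s ht0.ne' g, exists_horizontalDefect_iff hs0.ne' hab,
    exists_split_plane_iff hab, exists_rotated_plane_iff hab, norm_im_ge_half_iff (g 0 0)]
  have ha : g 0 1 = 0 → ‖g 0 0‖ = 1 := fun h => by
    rwa [h, map_zero, add_zero, Quaternion.normSq_eq_norm_mul_self, ← sq,
      pow_eq_one_iff_of_nonneg (norm_nonneg _) two_ne_zero] at hab
  have hb : g 0 0 = 0 → ‖g 0 1‖ = 1 := fun h => by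
    rwa [h, map_zero, zero_add, Quaternion.normSq_eq_norm_mul_self, ← sq,
      pow_eq_one_iff_of_nonneg (norm_nonneg _) two_ne_zero] at hab
  have h3 : g 0 1 = 0 ∧ ‖(g 0 0).im‖ ≥ 1 / 2 ↔
      g 0 1 = 0 ∧ Quaternion.normSq (g 0 0) ≤ 4 * Quaternion.normSq (g 0 0).im :=
    and_congr_right fun h => by rw [← norm_im_ge_half_iff, ha h]
  have h4 : g 0 0 = 0 ∧ ‖(g 0 1).im‖ ≥ 1 / 2 ↔
      g 0 0 = 0 ∧ Quaternion.normSq (g 0 1) ≤ 4 * Quaternion.normSq (g 0 1).im :=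
    and_congr_right fun h => by rw [← norm_im_ge_half_iff, hb h]
  rw [h3, h4]
  exact or_assoc.trans (or_congr_right or_comm)

end
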